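/- If S is a k-metric generator of the corona product G⊙H (G connected of order n ≥ 2, all H_i non-trivial connected), then for every i, S ∩ V(H_i) is a k-metric generator of G⊙H restricted appropriately: in particular |S ∩ V(H_i)| ≥ k, and S ∩ V(H_i) is a k-metric generator for H_i. -/

import Mathlib

open SimpleGraph

/-- `S` is a `k`-metric generator for `G`: every pair of distinct vertices is
distinguished (has different distances) by at least `k` vertices of `S`. -/
def kMetricGen {V : Type*} [Fintype V] (G : SimpleGraph V) (k : ℕ) (S : Set V) : Prop :=
  ∀ u v : V, u ≠ v → ∃ T : Finset V, ↑T ⊆ S ∧ k ≤ T.card ∧ ∀ w ∈ T, G.dist u w ≠ G.dist v w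

/-- `G` is `k`-metric dimensional: `k` is the largest integer admitting a `k`-metric generator. -/
def kMetricDimensional {V : Type*} [Fintype V] (G : SimpleGraph V) (k : ℕ) : Prop :=
  (∃ S : Set V, kMetricGen G k S) ∧ ∀ k' : ℕ, (∃ S : Set V, kMetricGen G k' S) → k' ≤ k

/-- The `k`-metric dimension of `G`. -/
noncomputable def kMetricDim {V : Type*} [Fintype V] (G : SimpleGraph V) (k : ℕ) : ℕ :=
  sInf {m | ∃ S : Finset V, kMetricGen G k ↑S ∧ S.card = m}

/-- A `k`-metric basis: a minimum-cardinality `k`-metric generator. -/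
def kMetricBasis {V : Type*} [Fintype V] (G : SimpleGraph V) (k : ℕ) (B : Finset V) : Prop :=
  kMetricGen G k ↑B ∧ ∀ T : Finset V, kMetricGen G k ↑T → B.card ≤ T.card

/-- Auxiliary relation for the corona product. -/
def coronaRel {V : Type*} {W : V → Type*} (G : SimpleGraph V) (H : ∀ v, SimpleGraph (W v)) :
    (V ⊕ (Σ v, W v)) → (V ⊕ (Σ v, W v)) → Prop
  | Sum.inl a, Sum.inl b => G.Adj a b
  | Sum.inl a, Sum.inr b => a = b.1
  | Sum.inr a, Sum.inr b => ∃ h : a.1 = b.1, (H b.1).Adj (h ▸ a.2) b.2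
  | _, _ => False

/-- The corona product `G ⊙ 𝓗`: one copy of `G`, and each vertex `v` of `G` joined by an
edge to every vertex of its own copy of `H v`. -/
def corona {V : Type*} {W : V → Type*} (G : SimpleGraph V) (H : ∀ v, SimpleGraph (W v)) :
    SimpleGraph (V ⊕ (Σ v, W v)) :=
  SimpleGraph.fromRel (coronaRel G H)

/-- The join `K₁ + H`: a new vertex (`none`) adjacent to every vertex of `H`. -/
def K1join {U : Type*} (H : SimpleGraph U) : SimpleGraph (Option U) :=
  SimpleGraph.fromRel (fun x y => match x, y with
    | none, some _ => True
    | some a, some b => H.Adj a b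
    | _, _ => False)

/-- `𝒞(H) = min_{x ≠ y} |(N(x) △ N(y)) ∪ {x,y}|`. -/
noncomputable def CC {U : Type*} (H : SimpleGraph U) : ℕ :=
  sInf {m | ∃ x y : U, x ≠ y ∧
    (symmDiff (H.neighborSet x) (H.neighborSet y) ∪ {x, y}).ncard = m}

theorem corona_adj_inr_inl {V : Type*} {W : V → Type*} (G : SimpleGraph V)
    (H : ∀ v, SimpleGraph (W v)) (a : Σ v, W v) (b : V) :
    (corona G H).Adj (Sum.inr a) (Sum.inl b) ↔ b = a.1 := by
  simp [corona, coronaRel]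

theorem corona_adj_inr_inr {V : Type*} {W : V → Type*} (G : SimpleGraph V)
    (H : ∀ v, SimpleGraph (W v)) (i : V) (x y : W i) :
    (corona G H).Adj (Sum.inr ⟨i, x⟩) (Sum.inr ⟨i, y⟩) ↔ (H i).Adj x y := by
  simp only [corona, coronaRel, SimpleGraph.fromRel_adj, exists_const]
  constructor
  · rintro ⟨-, h | h⟩
    exacts [h, h.symm]
  · exact fun h => ⟨by simpa using h.ne, Or.inl h⟩

theorem fst_eq_of_corona_adj_inr_inr {V : Type*} {W : V → Type*} {G : SimpleGraph V}
    {H : ∀ v, SimpleGraph (W v)} {a b : Σ v, W v}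
    (h : (corona G H).Adj (Sum.inr a) (Sum.inr b)) : b.1 = a.1 := by
  simp only [corona, coronaRel, SimpleGraph.fromRel_adj] at h
  obtain ⟨-, ⟨h, -⟩ | ⟨h, -⟩⟩ := h
  exacts [h.symm, h]

/-- A walk leaving the copy of `H i` can be rerouted to start at any other vertex of that copy
without becoming longer. -/
theorem exists_corona_walk_length_le {V : Type*} {W : V → Type*} {G : SimpleGraph V}
    {H : ∀ v, SimpleGraph (W v)} {i : V} (u : W i) {a w : V ⊕ (Σ v, W v)}
    (p : (corona G H).Walk a w) (ha : ∃ v : W i, a = Sum.inr ⟨i, v⟩)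
    (hw : ∀ x : W i, w ≠ Sum.inr ⟨i, x⟩) :
    ∃ q : (corona G H).Walk (Sum.inr ⟨i, u⟩) w, q.length ≤ p.length := by
  induction p with
  | nil =>
    obtain ⟨v, rfl⟩ := ha
    exact absurd rfl (hw v)
  | @cons a b w h p ih =>
    obtain ⟨v, rfl⟩ := ha
    rcases b with b | ⟨j, y⟩
    · have hb : b = i := (corona_adj_inr_inl G H _ _).1 h
      exact ⟨.cons ((corona_adj_inr_inl G H ⟨i, u⟩ b).2 hb) p, by simp⟩
    · obtain rfl : j = i := fst_eq_of_corona_adj_inr_inr h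
      obtain ⟨q, hq⟩ := ih ⟨y, rfl⟩ hw
      exact ⟨q, hq.trans (by simp)⟩

theorem corona_edist_le_of_outside {V : Type*} {W : V → Type*} {G : SimpleGraph V}
    {H : ∀ v, SimpleGraph (W v)} {i : V} (u v : W i) {w : V ⊕ (Σ v, W v)}
    (hw : ∀ x : W i, w ≠ Sum.inr ⟨i, x⟩) :
    (corona G H).edist (Sum.inr ⟨i, u⟩) w ≤ (corona G H).edist (Sum.inr ⟨i, v⟩) w := by
  refine le_iInf fun p => ?_
  obtain ⟨q, hq⟩ := exists_corona_walk_length_le u p ⟨v, rfl⟩ hw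
  exact (SimpleGraph.edist_le q).trans (by exact_mod_cast hq)

theorem corona_edist_le_of_dist_eq {V : Type*} {W : V → Type*} {G : SimpleGraph V}
    {H : ∀ v, SimpleGraph (W v)} {i : V} (hH : (H i).Connected) {u v x : W i}
    (h : (H i).dist u x = (H i).dist v x) :
    (corona G H).edist (Sum.inr ⟨i, u⟩) (Sum.inr ⟨i, x⟩) ≤
      (corona G H).edist (Sum.inr ⟨i, v⟩) (Sum.inr ⟨i, x⟩) := by
  refine le_iInf fun p => ?_
  rcases hp : p.length with _ | _ | n
  · obtain rfl : v = x := by simpa using SimpleGraph.Walk.eq_of_length_eq_zero hp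
    rw [SimpleGraph.dist_self, hH.dist_eq_zero_iff] at h
    simp [h]
  · have hadj := (corona_adj_inr_inr G H i v x).1 (SimpleGraph.Walk.adj_of_length_eq_one hp)
    rw [SimpleGraph.dist_eq_one_iff_adj.2 hadj, SimpleGraph.dist_eq_one_iff_adj] at h
    exact (SimpleGraph.edist_le ((corona_adj_inr_inr G H i u x).2 h).toWalk).trans (by simp)
  · have hu := (corona_adj_inr_inl G H ⟨i, u⟩ i).2 rfl
    have hx := (corona_adj_inr_inl G H ⟨i, x⟩ i).2 rfl
    refine (SimpleGraph.edist_le (.cons hu hx.symm.toWalk)).trans ?_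
    exact_mod_cast (by simp : _ ≤ n + 1 + 1)

/-- A vertex of the corona distinguishing two vertices of the copy of `H i` lies in that copy,
and distinguishes them already in `H i`. -/
theorem exists_of_corona_dist_ne {V : Type*} {W : V → Type*} {G : SimpleGraph V}
    {H : ∀ v, SimpleGraph (W v)} {i : V} (hH : (H i).Connected) {u v : W i}
    {w : V ⊕ (Σ v, W v)}
    (h : (corona G H).dist (Sum.inr ⟨i, u⟩) w ≠ (corona G H).dist (Sum.inr ⟨i, v⟩) w) :
    ∃ x : W i, w = Sum.inr ⟨i, x⟩ ∧ (H i).dist u x ≠ (H i).dist v x := by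
  by_contra! hw
  refine h (congrArg ENat.toNat ?_)
  by_cases hx : ∃ x : W i, w = Sum.inr ⟨i, x⟩
  · obtain ⟨x, rfl⟩ := hx
    have hd := hw x rfl
    exact le_antisymm (corona_edist_le_of_dist_eq hH hd) (corona_edist_le_of_dist_eq hH hd.symm)
  · push Not at hx
    exact le_antisymm (corona_edist_le_of_outside u v hx) (corona_edist_le_of_outside v u hx)

/-- if `S` is a `k`-metric generator for the corona product, then for every
copy `H i`, the trace of `S` on that copy has at least `k` elements and is a `k`-metric
generator for `H i`. -/
theorem stmt_13 {V : Type*} [Fintype V] (hn : 2 ≤ Fintype.card V) {W : V → Type*}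
    [∀ v, Fintype (W v)] [∀ v, Nontrivial (W v)] (G : SimpleGraph V) (hG : G.Connected)
    (H : ∀ v, SimpleGraph (W v)) (hH : ∀ v, (H v).Connected) (k : ℕ)
    (S : Set (V ⊕ (Σ v, W v))) (hS : kMetricGen (corona G H) k S) (i : V) :
    k ≤ {w : W i | Sum.inr ⟨i, w⟩ ∈ S}.ncard ∧
      kMetricGen (H i) k {w : W i | Sum.inr ⟨i, w⟩ ∈ S} := by
  classical
  have hgen : kMetricGen (H i) k {w : W i | Sum.inr ⟨i, w⟩ ∈ S} := by
    intro u v huv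
    obtain ⟨T, hTS, hk, hT⟩ := hS (Sum.inr ⟨i, u⟩) (Sum.inr ⟨i, v⟩) (by simpa using huv)
    have hinj : Function.Injective (fun x : W i => (Sum.inr ⟨i, x⟩ : V ⊕ (Σ v, W v))) :=
      Sum.inr_injective.comp sigma_mk_injective
    refine ⟨T.preimage _ hinj.injOn, fun x hx => hTS (by simpa using hx), hk.trans ?_, ?_⟩
    · rw [Finset.card_preimage, Finset.filter_true_of_mem]
      intro w hw
      obtain ⟨x, rfl, -⟩ := exists_of_corona_dist_ne (hH i) (hT w hw)
      exact ⟨x, rfl⟩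
    · intro x hx
      obtain ⟨y, hy, hd⟩ := exists_of_corona_dist_ne (hH i) (hT _ (Finset.mem_preimage.1 hx))
      obtain rfl := hinj hy
      exact hd
  refine ⟨?_, hgen⟩
  obtain ⟨u, v, huv⟩ := exists_pair_ne (W i)
  obtain ⟨T, hTS, hk, -⟩ := hgen u v huv
  rw [← Set.ncard_coe_finset] at hk
  exact hk.trans (Set.ncard_le_ncard hTS)
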